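/- The cyclic word abab in letters a, b is not equivalent to the empty cyclic word. -/

import Mathlib

/-- The two-letter alphabet `{a, b}`. -/
inductive AB : Type
  | a : AB
  | b : AB
deriving DecidableEq

/-- Equality of words up to cyclic rotation (equality as cyclic words). -/
def CycEq {α : Type*} (w₁ w₂ : List α) : Prop := ∃ n : ℕ, w₂ = w₁.rotate n

/-- The letter at the position cyclically following `i`. -/
def cnext {α : Type*} (w : List α) (i : Fin w.length) : α :=
  w.get ⟨(i.1 + 1) % w.length, Nat.mod_lt _ (Nat.lt_of_le_of_lt (Nat.zero_le _) i.isLt)⟩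

/-- Elementary cancellation of a cyclic word in letters `a`, `b`: deletion of two
cyclically adjacent equal letters. -/
def CancelW (w w' : List AB) : Prop :=
  ∃ (x : AB) (rest : List AB), CycEq w (x :: x :: rest) ∧ CycEq w' rest

/-- A cyclic word is economical if no two cyclically adjacent positions carry
equal letters (words of length at most 1 are economical). -/
def EconomicalW (w : List AB) : Prop :=
  2 ≤ w.length → ∀ i : Fin w.length, w.get i ≠ cnext w i


/-- Equivalence of cyclic words: generated by elementary cancellations
(in either direction). -/
def EquivW : List AB → List AB → Prop :=
  Relation.EqvGen (fun w w' => CycEq w w' ∨ CancelW w w')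

/-- Representation of the letters by transpositions. -/
def repAB : AB → Equiv.Perm (Fin 3)
  | AB.a => Equiv.swap 0 1
  | AB.b => Equiv.swap 1 2

theorem rep_prod_rotate (w : List AB) (n : ℕ) :
    ((w.rotate n).map repAB).prod = 1 ↔ (w.map repAB).prod = 1 := by
  induction n generalizing w with
  | zero => simp
  | succ n ih =>
    cases w with
    | nil => simp
    | cons x t =>
      rw [List.rotate_cons_succ, ih]
      simp only [List.map_append, List.map_cons, List.map_nil, List.prod_append, List.prod_cons,
        List.prod_nil, mul_one]
      exact mul_eq_one_iff_eq_inv.trans eq_inv_iff_mul_eq_one |>.trans mul_eq_one_comm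

theorem rep_cycEq {w w' : List AB} (h : CycEq w w') :
    (w.map repAB).prod = 1 ↔ (w'.map repAB).prod = 1 := by
  obtain ⟨n, rfl⟩ := h
  exact (rep_prod_rotate w n).symm

theorem rep_sq (x : AB) : repAB x * repAB x = 1 := by
  cases x <;> simp [repAB]

theorem rep_equivW {w w' : List AB} (h : EquivW w w') :
    (w.map repAB).prod = 1 ↔ (w'.map repAB).prod = 1 := by
  induction h with
  | rel u v h =>
    rcases h with h | ⟨x, rest, h1, h2⟩
    · exact rep_cycEq h
    · rw [rep_cycEq h1, rep_cycEq h2]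
      simp only [List.map_cons, List.prod_cons]
      rw [← mul_assoc, rep_sq, one_mul]
  | refl => rfl
  | symm _ _ _ ih => exact ih.symm
  | trans _ _ _ _ _ ih1 ih2 => exact ih1.trans ih2

/-- the cyclic word `abab` is not equivalent to the empty word. -/
theorem abab_not_equivalent_to_empty : ¬ EquivW [AB.a, AB.b, AB.a, AB.b] [] := by
  intro h
  have h1 := (rep_equivW h).2 (by simp)
  revert h1
  simp only [List.map_cons, List.map_nil, List.prod_cons, List.prod_nil, repAB]
  decide
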